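/- Let p : X̃ → X be a local homeomorphism, f : I → X a path, and x̃₀ ∈ p⁻¹(f(0)) such that there is no lift of f starting at x̃₀. Then the set A_f = {t ∈ I | f|_{[0,t]} has a lift f̂_t : [0,t] → X̃ with f̂_t(0) = x̃₀} is open and connected in I; in particular there exists α ∈ I such that A_f = [0, α). -/

import Mathlib

open unitInterval Set Topology

universe u

variable {E X : Type u} [TopologicalSpace E] [TopologicalSpace X]

/-- Path lifting property. -/
def HasPLP (p : E → X) : Prop :=
  ∀ f : I → X, Continuous f → ∀ e : E, p e = f 0 →
    ∃ g : I → E, Continuous g ∧ g 0 = e ∧ ∀ t, p (g t) = f t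

/-- Unique path lifting property. -/
def HasUPLP (p : E → X) : Prop :=
  ∀ g₁ g₂ : I → E, Continuous g₁ → Continuous g₂ →
    p ∘ g₁ = p ∘ g₂ → g₁ 0 = g₂ 0 → g₁ = g₂

/-- A semicovering is a local homeomorphism with UPLP and PLP. -/
def IsSemicovering (p : E → X) : Prop :=
  IsLocalHomeomorph p ∧ HasUPLP p ∧ HasPLP p

/-- A subsemicovering is a local homeomorphism extendable to a semicovering
via a topological embedding. -/
def IsSubsemicovering (p : E → X) : Prop :=
  IsLocalHomeomorph p ∧
  ∃ (Y : Type u) (_ : TopologicalSpace Y) (q : Y → X) (φ : E → Y),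
    IsSemicovering q ∧ IsEmbedding φ ∧ q ∘ φ = p

/-- The set of parameters `t` such that `f` restricted to `[0, t]` admits a lift
starting at `e`. -/
def liftSet (p : E → X) (f : I → X) (e : E) : Set I :=
  {t | ∃ g : I → E, ContinuousOn g (Set.Icc 0 t) ∧ g 0 = e ∧ ∀ s ∈ Set.Icc 0 t, p (g s) = f s}

/-- Strong unique path lifting property. -/
def HasStrongUPLP (p : E → X) : Prop :=
  ∀ f : I → X, Continuous f → ∀ e : E, p e = f 0 →
    (¬ ∃ g : I → E, Continuous g ∧ g 0 = e ∧ ∀ t, p (g t) = f t) →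
    ∀ (α : I) (g : I → E), liftSet p f e = Set.Ico 0 α →
      ContinuousOn g (Set.Ico 0 α) → g 0 = e → (∀ t ∈ Set.Ico 0 α, p (g t) = f t) →
      ∃ ε > (0 : ℝ), ∃ U : Set E, IsOpen U ∧
        (∀ t : I, (α : ℝ) - ε < t → t < α → g t ∈ U) ∧ Set.InjOn p U

/-- A continuous map `I → X` is null-homotopic (rel endpoints) if it is homotopic
relative to `{0,1}` to the constant path at its initial point. -/
def NullHomotopicRel (f : C(I, X)) : Prop :=
  f.HomotopicRel (ContinuousMap.const I (f 0)) {0, 1}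

omit [TopologicalSpace X] in
theorem zero_mem_liftSet {p : E → X} {f : I → X} {e : E} (he : p e = f 0) :
    0 ∈ liftSet p f e := by
  refine ⟨fun _ => e, continuousOn_const, rfl, fun s hs => ?_⟩
  rw [Icc_self, mem_singleton_iff] at hs
  rw [hs, he]

omit [TopologicalSpace X] in
theorem isLowerSet_liftSet (p : E → X) (f : I → X) (e : E) : IsLowerSet (liftSet p f e) := by
  rintro t s hst ⟨g, hg, h0, hpg⟩
  have hsub : Icc 0 s ⊆ Icc 0 t := Icc_subset_Icc_right hst
  exact ⟨g, hg.mono hsub, h0, fun r hr => hpg r (hsub hr)⟩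

omit [TopologicalSpace X] in
theorem exists_lift_of_one_mem_liftSet {p : E → X} {f : I → X} {e : E}
    (h : 1 ∈ liftSet p f e) :
    ∃ g : I → E, Continuous g ∧ g 0 = e ∧ ∀ t, p (g t) = f t := by
  obtain ⟨g, hg, h0, hpg⟩ := h
  refine ⟨g, ?_, h0, fun t => hpg t ⟨t.2.1, t.2.2⟩⟩
  rw [← continuousOn_univ]
  exact hg.mono fun t _ => ⟨t.2.1, t.2.2⟩

theorem isOpen_liftSet {p : E → X} (hp : IsLocalHomeomorph p) {f : I → X} (hf : Continuous f)
    (e : E) : IsOpen (liftSet p f e) := by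
  rw [isOpen_iff_mem_nhds]
  intro t ht
  obtain ⟨g, hg, h0, hpg⟩ := id ht
  obtain ⟨φ, hgt, rfl⟩ := hp (g t)
  have ht0 : (0 : I) ≤ t := t.2.1
  have hft : φ (g t) = f t := hpg t ⟨ht0, le_rfl⟩
  have hnhds : f ⁻¹' φ.target ∈ 𝓝 t :=
    (φ.open_target.preimage hf).mem_nhds (mem_preimage.2 (hft ▸ φ.map_source hgt))
  filter_upwards [ordConnectedComponent_mem_nhds.2 hnhds] with s hs
  rcases le_total s t with hst | hts
  · exact isLowerSet_liftSet _ f e hst ht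
  have hsub : Icc t s ⊆ f ⁻¹' φ.target := by
    rw [← uIcc_of_le hts]
    exact hs
  set h : I → E := fun r => if r ≤ t then g r else φ.symm (f r) with h_def
  have hleft : EqOn h g (Icc 0 t) := fun r hr => if_pos hr.2
  have hright : EqOn h (fun r => φ.symm (f r)) (Icc t s) := by
    intro r hr
    rcases hr.1.eq_or_lt with rfl | hlt
    · simp [h_def, ← hft, φ.left_inv hgt]
    · exact if_neg hlt.not_ge
  refine ⟨h, ?_, (hleft ⟨le_rfl, ht0⟩).trans h0, fun r hr => ?_⟩
  · rw [← Icc_union_Icc_eq_Icc ht0 hts]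
    exact (hg.congr hleft).union_of_isClosed
      ((φ.continuousOn_symm.comp hf.continuousOn hsub).congr hright) isClosed_Icc isClosed_Icc
  · rcases le_total r t with hrt | htr
    · rw [hleft ⟨hr.1, hrt⟩]
      exact hpg r ⟨hr.1, hrt⟩
    · rw [hright ⟨htr, hr.2⟩]
      exact φ.right_inv (hsub ⟨htr, hr.2⟩)

theorem IsLowerSet.exists_eq_Ico_zero {s : Set I} (hs : IsLowerSet s) (ho : IsOpen s)
    (h1 : 1 ∉ s) : ∃ α : I, s = Ico 0 α := by
  have hα : sInf sᶜ ∈ sᶜ := ho.isClosed_compl.csInf_mem ⟨1, h1⟩ (OrderBot.bddBelow _)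
  refine ⟨sInf sᶜ, Set.ext fun t => ⟨fun ht => ⟨t.2.1, ?_⟩, fun ht => ?_⟩⟩
  · exact lt_of_not_ge fun hle => hα (hs hle ht)
  · by_contra hts
    exact (csInf_le (OrderBot.bddBelow _) hts).not_gt ht.2

/-- If `f` has no full lift starting at `e`, the set of `t` such that `f|_{[0,t]}`
lifts starting at `e` is open and connected, and equals `[0, α)` for some `α`. -/
theorem stmt_2 {p : E → X} (hp : IsLocalHomeomorph p)
    (f : I → X) (hf : Continuous f) (e : E) (he : p e = f 0)
    (hnolift : ¬ ∃ g : I → E, Continuous g ∧ g 0 = e ∧ ∀ t, p (g t) = f t) :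
    IsOpen (liftSet p f e) ∧ IsConnected (liftSet p f e) ∧
      ∃ α : I, liftSet p f e = Set.Ico 0 α := by
  have ho := isOpen_liftSet hp hf e
  have hl := isLowerSet_liftSet p f e
  exact ⟨ho, ⟨⟨0, zero_mem_liftSet he⟩, hl.ordConnected.isPreconnected⟩,
    hl.exists_eq_Ico_zero ho fun h1 => hnolift (exists_lift_of_one_mem_liftSet h1)⟩
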